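/- arXiv:0810.3242 — 8 statements merged into one kernel-verified Lean document; each statement's English description precedes it below -/
import Mathlib

section
/- Let α be a nonzero algebraic integer in ℚ̄. Then α is a d-number if and only if there exist a positive integer m, a rational integer c, and a unit u of the ring of algebraic integers such that α^m = c·u. (Equivalence (i)⟺(iv) of Lemma 2.10.) -/
/-- `ℚ̄`, a fixed algebraic closure of `ℚ`. -/
abbrev Qbar : Type := AlgebraicClosure ℚ

/-- The principal ideal `α𝔸` of the ring of algebraic integers, viewed as a subset of `ℚ̄`. -/
def principalSet (α : Qbar) : Set Qbar :=
  {x | ∃ β : Qbar, IsIntegral ℤ β ∧ x = α * β}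

/-- `α` is a d-number: every field automorphism of `ℚ̄` maps the ideal `α𝔸` onto itself. -/
def IsDNumber (α : Qbar) : Prop :=
  ∀ g : Qbar ≃+* Qbar, g '' principalSet α = principalSet α

instance Qbar.isAlgebraic : Algebra.IsAlgebraic ℚ Qbar := by
  have h : (DivisionRing.toRatAlgebra : Algebra ℚ Qbar) = AlgebraicClosure.instAlgebra ℚ :=
    Subsingleton.elim _ _
  rw [h]
  exact AlgebraicClosure.isAlgebraic ℚ

instance Qbar.isAlgClosure : IsAlgClosure ℚ Qbar := ⟨inferInstance, inferInstance⟩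

instance Qbar.normal : Normal ℚ Qbar := IsAlgClosure.normal ℚ Qbar

theorem isDNumber_iff_isIntegral_div {α : Qbar} (hα : α ≠ 0) :
    IsDNumber α ↔ ∀ g : Qbar ≃+* Qbar, IsIntegral ℤ (g α / α) ∧ IsIntegral ℤ (α / g α) := by
  refine forall_congr' fun g => ?_
  have hg : g α ≠ 0 := by simpa using hα
  constructor
  · intro h
    constructor
    · have hmem : g α ∈ principalSet α := by
        rw [← h]
        exact ⟨α, ⟨1, isIntegral_one, by simp⟩, rfl⟩
      obtain ⟨β, hβ, e⟩ := hmem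
      rwa [e, mul_div_cancel_left₀ _ hα]
    · have hmem : α ∈ g '' principalSet α := by
        rw [h]
        exact ⟨1, isIntegral_one, by simp⟩
      obtain ⟨x, ⟨β, hβ, rfl⟩, e⟩ := hmem
      rw [map_mul] at e
      have e' : α / g α = g β := by rw [div_eq_iff hg, mul_comm, e]
      rw [e']
      exact map_isIntegral_int g hβ
  · rintro ⟨h₁, h₂⟩
    ext x
    constructor
    · rintro ⟨_, ⟨β, hβ, rfl⟩, rfl⟩
      refine ⟨g α / α * g β, h₁.mul (map_isIntegral_int g hβ), ?_⟩
      rw [map_mul]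
      field_simp
    · rintro ⟨β, hβ, rfl⟩
      refine ⟨α * g.symm (α / g α * β), ⟨_, map_isIntegral_int g.symm (h₂.mul hβ), rfl⟩, ?_⟩
      rw [map_mul, RingEquiv.apply_symm_apply]
      field_simp

theorem Multiset.isIntegral_prod_div_pow_card {K : Type*} [Field K] {a : K} (s : Multiset K)
    (h : ∀ x ∈ s, IsIntegral ℤ (x / a) ∧ IsIntegral ℤ (a / x)) :
    IsIntegral ℤ (s.prod / a ^ s.card) ∧ IsIntegral ℤ (a ^ s.card / s.prod) := by
  induction s using Multiset.induction_on with
  | empty => simp [isIntegral_one]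
  | cons x s ih =>
    obtain ⟨h₁, h₂⟩ := ih fun y hy => h y (Multiset.mem_cons_of_mem hy)
    obtain ⟨h₃, h₄⟩ := h x (Multiset.mem_cons_self x s)
    rw [Multiset.prod_cons, Multiset.card_cons, pow_succ', mul_div_mul_comm, mul_div_mul_comm]
    exact ⟨h₃.mul h₁, h₄.mul h₂⟩

theorem exists_ringEquiv_of_mem_aroots_minpoly {α x : Qbar}
    (hx : x ∈ (minpoly ℚ α).aroots Qbar) : ∃ g : Qbar ≃+* Qbar, g α = x := by
  obtain ⟨g, hg⟩ := minpoly.exists_algEquiv_of_root (Algebra.IsAlgebraic.isAlgebraic α)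
    (Polynomial.mem_aroots.mp hx).2
  exact ⟨g.symm, g.symm_apply_eq.mpr hg.symm⟩

theorem exists_int_eq_prod_aroots_minpoly {α : Qbar} (hint : IsIntegral ℤ α) :
    ∃ c : ℤ, ((minpoly ℚ α).aroots Qbar).prod = c := by
  have hs : ((minpoly ℚ α).map (algebraMap ℚ Qbar)).Splits := IsAlgClosed.splits _
  have hm : ((minpoly ℚ α).map (algebraMap ℚ Qbar)).Monic :=
    (minpoly.monic (Algebra.IsIntegral.isIntegral α)).map _
  have h := hs.coeff_zero_eq_prod_roots_of_monic hm
  rw [minpoly.isIntegrallyClosed_eq_field_fractions' ℚ hint] at h ⊢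
  refine ⟨(-1) ^ (minpoly ℤ α).natDegree * (minpoly ℤ α).coeff 0, ?_⟩
  simp only [Polynomial.coeff_map, eq_intCast, map_intCast,
    (minpoly.monic hint).natDegree_map, ((minpoly.monic hint).map _).natDegree_map] at h
  rw [Int.cast_mul, h, Int.cast_pow, Int.cast_neg, Int.cast_one, ← mul_assoc, ← mul_pow]
  simp [Polynomial.aroots]

/-- Equivalence (i) ⟺ (iv) of Lemma 2.10: `α` is a d-number iff some positive power of `α`
is a rational integer times a unit of the ring of algebraic integers. -/
theorem dNumber_iff_pow_eq_int_mul_unit (α : Qbar) (hα : α ≠ 0) (hint : IsIntegral ℤ α) :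
    IsDNumber α ↔ ∃ (m : ℕ) (c : ℤ) (u : (integralClosure ℤ Qbar)ˣ),
      0 < m ∧ α ^ m = (c : Qbar) * ((u : integralClosure ℤ Qbar) : Qbar) := by
  rw [isDNumber_iff_isIntegral_div hα]
  constructor
  · intro h
    obtain ⟨c, hc⟩ := exists_int_eq_prod_aroots_minpoly hint
    set s := (minpoly ℚ α).aroots Qbar
    have hs0 : s.prod ≠ 0 := by
      refine Multiset.prod_ne_zero fun h0 => ?_
      obtain ⟨g, hg⟩ := exists_ringEquiv_of_mem_aroots_minpoly h0
      exact hα (by simpa using hg)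
    obtain ⟨h₁, h₂⟩ := s.isIntegral_prod_div_pow_card (a := α) fun x hx => by
      obtain ⟨g, rfl⟩ := exists_ringEquiv_of_mem_aroots_minpoly hx
      exact h g
    have hpow : α ^ s.card ≠ 0 := pow_ne_zero _ hα
    refine ⟨s.card, c, ⟨⟨_, h₂⟩, ⟨_, h₁⟩, Subtype.ext ?_, Subtype.ext ?_⟩, ?_, ?_⟩
    · simp [hs0, hpow]
    · simp [hs0, hpow]
    · refine Multiset.card_pos_iff_exists_mem.mpr ⟨α, ?_⟩
      exact Polynomial.mem_aroots.mpr
        ⟨minpoly.ne_zero (Algebra.IsIntegral.isIntegral α), minpoly.aeval ℚ α⟩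
    · rw [← hc]
      exact (mul_div_cancel₀ _ hs0).symm
  · rintro ⟨m, c, u, hm, e⟩ g
    have hc : (c : Qbar) ≠ 0 := by
      intro h0
      rw [h0, zero_mul] at e
      exact pow_ne_zero m hα e
    have hu : IsIntegral ℤ ((u : integralClosure ℤ Qbar) : Qbar) := u.val.2
    have hv : IsIntegral ℤ ((u : integralClosure ℤ Qbar) : Qbar)⁻¹ := by
      have huv : ((u : integralClosure ℤ Qbar) : Qbar) *
          ((u⁻¹ : (integralClosure ℤ Qbar)ˣ) : integralClosure ℤ Qbar) = 1 :=
        congrArg Subtype.val u.mul_inv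
      rw [inv_eq_of_mul_eq_one_right huv]
      exact (u⁻¹).val.2
    have eg : g α ^ m = c * g ((u : integralClosure ℤ Qbar) : Qbar) := by
      rw [← map_pow, e, map_mul, map_intCast]
    constructor
    · refine IsIntegral.of_pow hm ?_
      rw [div_pow, e, eg, mul_div_mul_left _ _ hc, div_eq_mul_inv]
      exact (map_isIntegral_int g hu).mul hv
    · refine IsIntegral.of_pow hm ?_
      rw [div_pow, e, eg, mul_div_mul_left _ _ hc, div_eq_mul_inv, ← map_inv₀]
      exact hu.mul (map_isIntegral_int g hv)
end

section
/- Let α be a nonzero algebraic integer in ℚ̄ such that α/g(α) is a unit of the ring of algebraic integers for every field automorphism g of ℚ̄. Let p ∈ ℤ[x] be the (monic) minimal polynomial of α over ℚ and let n be its degree. Then there exists a unit u of the ring of algebraic integers with α^n = p(0)·u. -/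
/-- If `a` agrees with every member of a multiset `s` up to a unit of the subalgebra `S`, then
`a ^ card s` agrees with the product of `s` up to a unit of `S`. -/
theorem Multiset.exists_unit_pow_card_eq_prod_mul {R A : Type*} [CommRing R] [CommRing A]
    [Algebra R A] (S : Subalgebra R A) (a : A) (s : Multiset A)
    (h : ∀ r ∈ s, ∃ u : Sˣ, a = r * ((u : S) : A)) :
    ∃ u : Sˣ, a ^ s.card = s.prod * ((u : S) : A) := by
  induction s using Multiset.induction with
  | empty => exact ⟨1, by simp⟩
  | cons r s ih =>
    obtain ⟨u, hu⟩ := ih fun x hx => h x (Multiset.mem_cons_of_mem hx)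
    obtain ⟨v, hv⟩ := h r (Multiset.mem_cons_self r s)
    refine ⟨u * v, ?_⟩
    rw [Multiset.card_cons, pow_succ, hu, Multiset.prod_cons, Units.val_mul, Subalgebra.coe_mul]
    linear_combination s.prod * ((u : S) : A) * hv

/-- If `α / g(α)` is a unit of the ring of algebraic integers for every field automorphism `g`
of `ℚ̄`, and `p ∈ ℤ[x]` is the monic minimal polynomial of `α` over `ℚ` of degree `n`, then
`α ^ n = p(0) · u` for some unit `u` of the ring of algebraic integers. -/
theorem pow_natDegree_eq_constTerm_mul_unit (α : Qbar) (hα : α ≠ 0) (hint : IsIntegral ℤ α)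
    (hunit : ∀ g : Qbar ≃+* Qbar, ∃ u : (integralClosure ℤ Qbar)ˣ,
      α / g α = ((u : integralClosure ℤ Qbar) : Qbar))
    (p : Polynomial ℤ) (hp : p.Monic)
    (hmin : p.map (algebraMap ℤ ℚ) = minpoly ℚ α) :
    ∃ u : (integralClosure ℤ Qbar)ˣ,
      α ^ p.natDegree = ((p.eval 0 : ℤ) : Qbar) * ((u : integralClosure ℤ Qbar) : Qbar) := by
  have halg : Algebra.IsAlgebraic ℚ Qbar := by
    have h : (DivisionRing.toRatAlgebra : Algebra ℚ Qbar) = AlgebraicClosure.instAlgebra ℚ :=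
      Subsingleton.elim _ _
    rw [h]
    exact AlgebraicClosure.isAlgebraic ℚ
  have hnormal : Normal ℚ Qbar := normal_iff.2 fun x =>
    ⟨Algebra.IsIntegral.isIntegral x, IsAlgClosed.splits _⟩
  have hmap : p.map (algebraMap ℤ Qbar) = (minpoly ℚ α).map (algebraMap ℚ Qbar) := by
    rw [← hmin, Polynomial.map_map, ← IsScalarTower.algebraMap_eq]
  have hsplits : (p.map (algebraMap ℤ Qbar)).Splits := IsAlgClosed.splits _
  have hcard : (p.map (algebraMap ℤ Qbar)).roots.card = p.natDegree := by
    rw [← hsplits.natDegree_eq_card_roots, hp.natDegree_map]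
  have hconst : ((p.eval 0 : ℤ) : Qbar) =
      (-1) ^ p.natDegree * (p.map (algebraMap ℤ Qbar)).roots.prod := by
    have h := hsplits.coeff_zero_eq_prod_roots_of_monic (hp.map _)
    rwa [Polynomial.coeff_map, hp.natDegree_map, Polynomial.coeff_zero_eq_eval_zero,
      eq_intCast] at h
  obtain ⟨u, hu⟩ := Multiset.exists_unit_pow_card_eq_prod_mul (integralClosure ℤ Qbar) α
    (p.map (algebraMap ℤ Qbar)).roots fun r hr => by
      have hroot : Polynomial.aeval r (minpoly ℚ α) = 0 := by
        rw [Polynomial.aeval_def, ← Polynomial.eval_map, ← hmap]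
        exact Polynomial.isRoot_of_mem_roots hr
      have hconj : IsConjRoot ℚ α r :=
        (isConjRoot_iff_aeval_eq_zero (Algebra.IsIntegral.isIntegral α)).2 hroot
      obtain ⟨σ, rfl⟩ := isConjRoot_iff_exists_algEquiv.1 hconj.symm
      obtain ⟨v, hv⟩ := hunit σ.toRingEquiv
      refine ⟨v, ?_⟩
      rw [← hv]
      exact (mul_div_cancel₀ α ((map_ne_zero σ).2 hα)).symm
  refine ⟨(-1) ^ p.natDegree * u, ?_⟩
  rw [hcard] at hu
  rw [hu, hconst]
  have hsign : ((-1 : Qbar) ^ p.natDegree) * (-1) ^ p.natDegree = 1 := by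
    rw [← mul_pow]
    simp
  push_cast
  linear_combination -((p.map (algebraMap ℤ Qbar)).roots.prod * (u : integralClosure ℤ Qbar)) * hsign
end

section
/- Let α be a nonzero algebraic integer in ℚ̄ with minimal polynomial p(x) = x^n + a_1 x^{n-1} + … + a_n over ℚ (so all a_i ∈ ℤ). Then α is a d-number if and only if for every i = 1, …, n the integer (a_i)^n is divisible by (a_n)^i. (Equivalence (i)⟺(v) of Lemma 2.10.) -/
open Polynomial in
theorem Polynomial.isIntegral_coeff_of_forall_isIntegral_roots {K : Type*} [Field K] {P : K[X]}
    (hP : P.Monic) (hs : P.Splits) (h : ∀ r ∈ P.roots, IsIntegral ℤ r) (k : ℕ) :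
    IsIntegral ℤ (P.coeff k) := by
  have hmem : P ∈ lifts (integralClosure ℤ K).subtype := by
    rw [hs.eq_prod_roots_of_monic hP]
    refine multiset_prod_mem _ fun q hq => ?_
    obtain ⟨r, hr, rfl⟩ := Multiset.mem_map.1 hq
    exact (lifts_iff_coeff_lifts _).2 fun j => by
      have hX : IsIntegral ℤ ((X - C r).coeff j) := by
        rw [coeff_sub, coeff_X, coeff_C]
        refine IsIntegral.sub ?_ ?_ <;> split_ifs
        exacts [isIntegral_one, isIntegral_zero, h r hr, isIntegral_zero]
      exact ⟨⟨_, hX⟩, rfl⟩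
  obtain ⟨x, hx⟩ := (lifts_iff_coeff_lifts _).1 hmem k
  exact hx ▸ x.2

theorem Int.dvd_of_isIntegral_div {K : Type*} [Field K] [CharZero K] {a b : ℤ} (hb : b ≠ 0)
    (h : IsIntegral ℤ ((a : K) / b)) : b ∣ a := by
  have hq : IsIntegral ℤ ((a : ℚ) / b) := by
    refine (isIntegral_algebraMap_iff (A := ℚ) (B := K) (algebraMap ℚ K).injective).1 ?_
    simpa using h
  obtain ⟨c, hc⟩ := IsIntegrallyClosed.isIntegral_iff.1 hq
  refine ⟨c, ?_⟩
  have hb' : (b : ℚ) ≠ 0 := by exact_mod_cast hb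
  rw [eq_div_iff hb'] at hc
  have : (c : ℚ) * b = a := by simpa using hc
  rw [mul_comm]
  exact_mod_cast this.symm

open Polynomial in
/-- If `(aₙ)^i ∣ (aᵢ)^n` for all `i` and `c^n = aₙ`, then a root of `p` is a unit multiple of `c`
among the algebraic integers. -/
theorem isIntegral_div_of_coeff_dvd {K : Type*} [Field K] {p : ℤ[X]}
    (hp : p.Monic) (hn : p.natDegree ≠ 0)
    (h : ∀ i : ℕ, 1 ≤ i → i ≤ p.natDegree →
      (p.coeff 0) ^ i ∣ (p.coeff (p.natDegree - i)) ^ p.natDegree)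
    {c β : K} (hc0 : c ≠ 0) (hc : c ^ p.natDegree = p.coeff 0)
    (hβ : aeval β p = 0) : IsIntegral ℤ (β / c) ∧ IsIntegral ℤ (c / β) := by
  set n := p.natDegree with hn_def
  have hcoeff : ∀ j ≤ n, IsIntegral ℤ ((p.coeff j : K) / c ^ (n - j)) := by
    intro j hj
    rcases hj.eq_or_lt with rfl | hj
    · simp [hn_def, hp.coeff_natDegree, isIntegral_one]
    · refine IsIntegral.of_pow (Nat.pos_of_ne_zero hn) ?_
      obtain ⟨d, hd⟩ := h (n - j) (by omega) (by omega)
      rw [show n - (n - j) = j by omega] at hd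
      have : ((p.coeff j : K) / c ^ (n - j)) ^ n = d := by
        rw [div_pow, ← pow_mul, mul_comm (n - j), pow_mul, hc,
          div_eq_iff, ← Int.cast_pow, hd]
        · push_cast; ring
        · exact pow_ne_zero _ (hc ▸ pow_ne_zero _ hc0)
      rw [this]
      exact isIntegral_algebraMap (R := ℤ) (A := K) (x := d)
  have hsum : ∑ j ∈ Finset.range (n + 1), (p.coeff j : K) / c ^ (n - j) * (β / c) ^ j = 0 := by
    have hz : ∑ j ∈ Finset.range (n + 1), (p.coeff j : K) * β ^ j = 0 := by
      rw [← hβ, aeval_eq_sum_range]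
      simp [zsmul_eq_mul, hn_def]
    rw [← zero_div (c ^ n), ← hz, Finset.sum_div]
    refine Finset.sum_congr rfl fun j hj => ?_
    have hj : j ≤ n := Nat.lt_succ_iff.1 (Finset.mem_range.1 hj)
    rw [← pow_sub_mul_pow c hj, div_pow]
    field_simp
  have hlead : (p.coeff n : K) = 1 := by simp [hn_def, hp.coeff_natDegree]
  have hint : IsIntegral ℤ (β / c) := by
    let S := integralClosure ℤ K
    let a : ℕ → S := fun j => if hj : j ≤ n then ⟨_, hcoeff j hj⟩ else 0
    have ha : ∀ j ≤ n, ((a j : S) : K) = (p.coeff j : K) / c ^ (n - j) := fun j hj => by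
      simp [a, hj]
    refine isIntegral_trans (R := ℤ) (A := S) _
      ⟨X ^ n + ∑ j ∈ Finset.range n, C (a j) * X ^ j, ?_, ?_⟩
    · rw [Finset.sum_range]
      exact monic_X_pow_add (degree_sum_fin_lt _)
    · rw [Finset.sum_range_succ] at hsum
      simp only [Nat.sub_self, hlead, pow_zero, div_one, one_mul] at hsum
      rw [← hsum, eval₂_add, eval₂_finsetSum, eval₂_X_pow, add_comm]
      congr 1
      refine Finset.sum_congr rfl fun j hj => ?_
      rw [eval₂_mul, eval₂_C, eval₂_X_pow, ← ha j (Finset.mem_range.1 hj).le]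
      rfl
  refine ⟨hint, ?_⟩
  have hinv : c / β = -∑ j ∈ Finset.range n,
      (p.coeff (j + 1) : K) / c ^ (n - (j + 1)) * (β / c) ^ j := by
    rw [Finset.sum_range_succ'] at hsum
    simp only [Nat.sub_zero, pow_zero, mul_one, pow_succ (β / c), ← mul_assoc,
      ← Finset.sum_mul] at hsum
    rw [← hc, div_self (pow_ne_zero _ hc0)] at hsum
    rw [← inv_div]
    refine inv_eq_of_mul_eq_one_left ?_
    linear_combination -hsum
  rw [hinv]
  refine (IsIntegral.sum _ fun j hj => ?_).neg
  exact (hcoeff _ (Finset.mem_range.1 hj)).mul (hint.pow j)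

open Polynomial in
/-- If all roots of `p` are unit multiples of `α` among the algebraic integers, then
`(aₙ)^i ∣ (aᵢ)^n` for all `i`. -/
theorem coeff_dvd_of_isIntegral_div {K : Type*} [Field K] [CharZero K] {p : ℤ[X]}
    (hp : p.Monic) (hs : (p.map (algebraMap ℤ K)).Splits) (hp0 : p.coeff 0 ≠ 0)
    {α : K} (hα : α ≠ 0)
    (h : ∀ β : K, aeval β p = 0 → IsIntegral ℤ (β / α) ∧ IsIntegral ℤ (α / β))
    {i : ℕ} (hi : i ≤ p.natDegree) :
    (p.coeff 0) ^ i ∣ (p.coeff (p.natDegree - i)) ^ p.natDegree := by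
  set n := p.natDegree with hn_def
  set P := p.map (algebraMap ℤ K) with hP_def
  have hP : P.Monic := hp.map _
  have hPn : P.natDegree = n := hp.natDegree_map _
  have hPc : ∀ j, P.coeff j = (p.coeff j : K) := fun j => by simp [hP_def]
  have hroot : ∀ r ∈ P.roots, aeval r p = 0 := fun r hr => by
    have := isRoot_of_mem_roots hr
    rwa [IsRoot, hP_def, eval_map_algebraMap] at this
  have hcoeff : IsIntegral ℤ ((p.coeff (n - i) : K) / α ^ i) := by
    have hsr : (P.scaleRoots α⁻¹).Splits := hs.scaleRoots _
    have := isIntegral_coeff_of_forall_isIntegral_roots (P := P.scaleRoots α⁻¹)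
      ((monic_scaleRoots_iff _).2 hP) hsr (fun r hr => ?_) (n - i)
    · rwa [coeff_scaleRoots, hPn, Nat.sub_sub_self hi, hPc, inv_pow, ← div_eq_mul_inv] at this
    · rw [roots_scaleRoots _ (inv_ne_zero hα).isUnit] at hr
      obtain ⟨β, hβ, rfl⟩ := Multiset.mem_map.1 hr
      rw [← div_eq_inv_mul]
      exact (h β (hroot β hβ)).1
  have hconst : IsIntegral ℤ (α ^ n / (p.coeff 0 : K)) := by
    have hprod : α ^ n / (P.roots.prod) = (P.roots.map fun β => α / β).prod := by
      rw [Multiset.prod_map_div, Multiset.map_const', Multiset.prod_replicate, Multiset.map_id',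
        ← hs.natDegree_eq_card_roots, hPn]
    rw [← hPc 0, hs.coeff_zero_eq_prod_roots_of_monic hP, mul_comm, ← div_div, hprod,
      div_eq_mul_inv, ← inv_pow, inv_neg_one]
    refine (IsIntegral.multiset_prod fun x hx => ?_).mul (isIntegral_one.neg.pow _)
    obtain ⟨β, hβ, rfl⟩ := Multiset.mem_map.1 hx
    exact (h β (hroot β hβ)).2
  refine Int.dvd_of_isIntegral_div (K := K) (pow_ne_zero _ hp0) ?_
  have : (((p.coeff (n - i)) ^ n : ℤ) : K) / ((p.coeff 0 ^ i : ℤ) : K) =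
      ((p.coeff (n - i) : K) / α ^ i) ^ n * (α ^ n / (p.coeff 0 : K)) ^ i := by
    have : (p.coeff 0 : K) ≠ 0 := by exact_mod_cast hp0
    push_cast
    rw [div_pow, div_pow, ← pow_mul, ← pow_mul, mul_comm i n]
    field_simp
  rw [this]
  exact (hcoeff.pow n).mul (hconst.pow i)

/-- Equivalence (i) ⟺ (v) of Lemma 2.10: if `p(x) = x^n + a₁ x^(n-1) + ⋯ + aₙ ∈ ℤ[x]` is the
minimal polynomial of `α` over `ℚ` (here `aᵢ = p.coeff (n - i)`), then `α` is a d-number iff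
`(aₙ)^i ∣ (aᵢ)^n` for every `i = 1, …, n`. -/
theorem dNumber_iff_minpoly_coeff_dvd (α : Qbar) (hα : α ≠ 0) (hint : IsIntegral ℤ α)
    (p : Polynomial ℤ) (hp : p.Monic)
    (hmin : p.map (algebraMap ℤ ℚ) = minpoly ℚ α) :
    IsDNumber α ↔ ∀ i : ℕ, 1 ≤ i → i ≤ p.natDegree →
      (p.coeff 0) ^ i ∣ (p.coeff (p.natDegree - i)) ^ p.natDegree := by
  have hβ (g : Qbar ≃+* Qbar) : Polynomial.aeval (g α) p = 0 := by
    have h0 : Polynomial.aeval α p = 0 := by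
      rw [← Polynomial.aeval_map_algebraMap ℚ, hmin, minpoly.aeval]
    have := Polynomial.aeval_algHom_apply g.toRingHom.toIntAlgHom α p
    rw [h0, map_zero] at this
    exact this
  have hp0 : p.coeff 0 ≠ 0 := by
    have := minpoly.coeff_zero_ne_zero (hint.tower_top (A := ℚ)) hα
    rw [← hmin, Polynomial.coeff_map] at this
    exact fun h => this (by rw [h, map_zero])
  have hn : p.natDegree ≠ 0 := by
    rw [← hp.natDegree_map (algebraMap ℤ ℚ), hmin]
    exact (minpoly.natDegree_pos (hint.tower_top (A := ℚ))).ne'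
  rw [isDNumber_iff_isIntegral_div hα]
  constructor
  · intro h i _ hi
    refine coeff_dvd_of_isIntegral_div (K := Qbar) hp (IsAlgClosed.splits _) hp0 hα
      (fun β hβ => ?_) hi
    have hc : IsConjRoot ℚ β α := by
      refine IsConjRoot.symm ((isConjRoot_iff_aeval_eq_zero (hint.tower_top (A := ℚ))).2 ?_)
      rwa [← hmin, Polynomial.aeval_map_algebraMap]
    have : Normal ℚ Qbar := by
      rw [Subsingleton.elim (DivisionRing.toRatAlgebra : Algebra ℚ Qbar)
        (AlgebraicClosure.instAlgebra ℚ)]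
      exact @IsAlgClosure.normal ℚ (AlgebraicClosure ℚ) _ _
        (AlgebraicClosure.instAlgebra ℚ) (AlgebraicClosure.instIsAlgClosure ℚ)
    obtain ⟨g, hg⟩ := hc.exists_algEquiv
    have := h g.toRingEquiv
    have hg' : g.toRingEquiv α = β := hg
    rwa [hg'] at this
  · intro h g
    obtain ⟨c, hc⟩ := IsAlgClosed.exists_pow_nat_eq (p.coeff 0 : Qbar) (Nat.pos_of_ne_zero hn)
    have hc0 : c ≠ 0 := by
      rintro rfl
      rw [zero_pow hn] at hc
      exact hp0 (by exact_mod_cast hc.symm)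
    have h₁ := isIntegral_div_of_coeff_dvd hp hn h hc0 hc (hβ (RingEquiv.refl _))
    have h₂ := isIntegral_div_of_coeff_dvd hp hn h hc0 hc (hβ g)
    constructor
    · exact div_mul_div_cancel₀ (a := g α) (c := α) hc0 ▸ h₂.1.mul h₁.2
    · exact div_mul_div_cancel₀ (a := α) (c := g α) hc0 ▸ h₁.1.mul h₂.2
end

section
/- Let α be a nonzero algebraic integer in ℚ̄ and suppose there exists a monic polynomial p(x) = x^m + a_1 x^{m-1} + … + a_m with integer coefficients such that p(α) = 0 and for every i = 1, …, m the integer (a_i)^m is divisible by (a_m)^i. Then α is a d-number. (Implication (vi)⟹(i) of Lemma 2.10.) -/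
open Polynomial in
/-- An element satisfying a monic equation with integral coefficients is integral. -/
theorem isIntegral_of_sum_range_add_pow_eq_zero {K : Type*} [CommRing K] {n : ℕ} {b : ℕ → K}
    {x : K} (hb : ∀ j, j < n → IsIntegral ℤ (b j))
    (h : ∑ j ∈ Finset.range n, b j * x ^ j + x ^ n = 0) : IsIntegral ℤ x := by
  classical
  let c : ℕ → integralClosure ℤ K := fun j => if hj : j < n then ⟨b j, hb j hj⟩ else 0
  have hc : ∀ j ∈ Finset.range n, algebraMap (integralClosure ℤ K) K (c j) = b j := by
    intro j hj
    simp only [c, dif_pos (Finset.mem_range.mp hj)]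
    rfl
  refine isIntegral_trans (A := integralClosure ℤ K) x
    ⟨X ^ n + ∑ j ∈ Finset.range n, C (c j) * X ^ j, monic_X_pow_add ?_, ?_⟩
  · refine (degree_sum_le _ _).trans_lt <|
      (Finset.sup_lt_iff (WithBot.bot_lt_coe n)).2 fun j hj => ?_
    exact (degree_C_mul_X_pow_le j _).trans_lt (Nat.cast_lt.mpr (Finset.mem_range.mp hj))
  · simp only [eval₂_add, eval₂_X_pow, eval₂_finsetSum, eval₂_mul, eval₂_C]
    rw [add_comm, ← h]
    congr 1
    exact Finset.sum_congr rfl fun j hj => by rw [hc j hj]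

/-- If `c ^ m = p(0)` for a monic integer polynomial `p` of degree `m` whose coefficients satisfy
the divisibility condition, then any root of `p` is a unit multiple of `c`. -/
theorem isIntegral_div_of_coeff_dvd_s5 {K : Type*} [Field K] [CharZero K] {α c : K} {p : Polynomial ℤ}
    (hp : p.Monic) (hroot : Polynomial.aeval α p = 0) (hm : p.natDegree ≠ 0)
    (h0 : p.coeff 0 ≠ 0) (hc : c ^ p.natDegree = p.coeff 0)
    (hdvd : ∀ i : ℕ, 1 ≤ i → i ≤ p.natDegree →
      (p.coeff 0) ^ i ∣ (p.coeff (p.natDegree - i)) ^ p.natDegree) :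
    IsIntegral ℤ (α / c) ∧ IsIntegral ℤ (α / c)⁻¹ := by
  have hc0 : c ≠ 0 := by
    rintro rfl
    rw [zero_pow hm] at hc
    exact h0 (by exact_mod_cast hc.symm)
  set m := p.natDegree with hmdef
  set b : ℕ → K := fun j => p.coeff j / c ^ (m - j) with hbdef
  have hbm : b m = 1 := by simp [hbdef, hmdef, hp.coeff_natDegree]
  have hb0 : b 0 = 1 := by
    have : c ^ m ≠ 0 := pow_ne_zero _ hc0
    simp only [hbdef, Nat.sub_zero, ← hc]
    exact div_self this
  have hb : ∀ j, j ≤ m → IsIntegral ℤ (b j) := by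
    intro j hj
    rcases hj.eq_or_lt with rfl | hlt
    · rw [hbm]; exact isIntegral_one
    · obtain ⟨k, hk⟩ := hdvd (m - j) (by omega) (by omega)
      rw [Nat.sub_sub_self hj] at hk
      refine IsIntegral.of_pow (Nat.pos_of_ne_zero hm) ?_
      have : b j ^ m = algebraMap ℤ K k := by
        have hk' : (p.coeff j : K) ^ m = (p.coeff 0 : K) ^ (m - j) * k := by exact_mod_cast hk
        simp only [hbdef, div_pow]
        rw [hk', ← hc, ← pow_mul, ← pow_mul, mul_comm m,
          mul_div_cancel_left₀ _ (pow_ne_zero _ hc0)]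
        simp
      rw [this]
      exact isIntegral_algebraMap
  have hsum : ∑ j ∈ Finset.range (m + 1), b j * (α / c) ^ j = 0 := by
    have hs : ∑ j ∈ Finset.range (m + 1), (p.coeff j : K) * α ^ j = 0 := by
      rw [Polynomial.aeval_eq_sum_range] at hroot
      simpa [zsmul_eq_mul] using hroot
    rw [← zero_div (c ^ m), ← hs, Finset.sum_div]
    refine Finset.sum_congr rfl fun j hj => ?_
    have hj' : m - j + j = m := Nat.sub_add_cancel (Nat.lt_succ_iff.mp (Finset.mem_range.mp hj))
    simp only [hbdef, div_pow]
    rw [div_mul_div_comm, ← pow_add, hj']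
  have hint : IsIntegral ℤ (α / c) := by
    refine isIntegral_of_sum_range_add_pow_eq_zero (n := m) (fun j hj => hb j hj.le) ?_
    rw [← hsum, Finset.sum_range_succ, hbm, one_mul]
  refine ⟨hint, ?_⟩
  have hinv : (α / c)⁻¹ = -∑ j ∈ Finset.range m, b (j + 1) * (α / c) ^ j := by
    refine inv_eq_of_mul_eq_one_right ?_
    rw [Finset.sum_range_succ', hb0, pow_zero, one_mul] at hsum
    rw [mul_neg, Finset.mul_sum, neg_eq_iff_eq_neg, ← add_eq_zero_iff_eq_neg, ← hsum]
    congr 1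
    exact Finset.sum_congr rfl fun j _ => by ring
  rw [hinv]
  exact (IsIntegral.sum _ fun j hj =>
    (hb _ (Finset.mem_range.mp hj)).mul (hint.pow j)).neg

/-- The equality `β𝔸 = α𝔸` holds as soon as `β / α` is a unit of `𝔸`. -/
theorem principalSet_eq_of_isIntegral_div {α β : Qbar} (hα : α ≠ 0) (hβ : β ≠ 0)
    (h : IsIntegral ℤ (β / α)) (h' : IsIntegral ℤ (α / β)) :
    principalSet β = principalSet α := by
  ext x
  constructor
  · rintro ⟨y, hy, rfl⟩
    exact ⟨β / α * y, h.mul hy, by field_simp⟩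
  · rintro ⟨y, hy, rfl⟩
    exact ⟨α / β * y, h'.mul hy, by field_simp⟩

/-- A field automorphism maps `α𝔸` onto `g(α)𝔸`. -/
theorem image_principalSet (g : Qbar ≃+* Qbar) (α : Qbar) :
    g '' principalSet α = principalSet (g α) := by
  ext x
  constructor
  · rintro ⟨_, ⟨y, hy, rfl⟩, rfl⟩
    exact ⟨g y, map_isIntegral_int g hy, map_mul g α y⟩
  · rintro ⟨y, hy, rfl⟩
    exact ⟨α * g.symm y, ⟨_, map_isIntegral_int g.symm hy, rfl⟩, by simp⟩

/-- Implication (vi) ⟹ (i) of Lemma 2.10: if `α` is a nonzero algebraic integer which is a root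
of some monic polynomial `p(x) = x^m + a₁ x^(m-1) + ⋯ + aₘ ∈ ℤ[x]` (here `aᵢ = p.coeff (m - i)`)
such that `(aₘ)^i ∣ (aᵢ)^m` for every `i = 1, …, m`, then `α` is a d-number. -/
theorem isDNumber_of_poly_coeff_dvd (α : Qbar) (hα : α ≠ 0) (hint : IsIntegral ℤ α)
    (p : Polynomial ℤ) (hp : p.Monic) (hroot : Polynomial.aeval α p = 0)
    (hdvd : ∀ i : ℕ, 1 ≤ i → i ≤ p.natDegree →
      (p.coeff 0) ^ i ∣ (p.coeff (p.natDegree - i)) ^ p.natDegree) :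
    IsDNumber α := by
  have hm : p.natDegree ≠ 0 := by
    intro h
    rw [hp.natDegree_eq_zero.mp h] at hroot
    simp at hroot
  have h0 : p.coeff 0 ≠ 0 := by
    intro h
    have hX : p = Polynomial.X ^ p.natDegree := by
      ext j
      rw [Polynomial.coeff_X_pow]
      split_ifs with hj
      · rw [hj, hp.coeff_natDegree]
      · rcases lt_or_gt_of_ne hj with hlt | hgt
        · have hd := hdvd (p.natDegree - j) (by omega) (by omega)
          rw [h, zero_pow (by omega), zero_dvd_iff, Nat.sub_sub_self hlt.le] at hd
          exact eq_zero_of_pow_eq_zero hd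
        · exact Polynomial.coeff_eq_zero_of_natDegree_lt hgt
    rw [hX] at hroot
    simp only [map_pow, Polynomial.aeval_X] at hroot
    exact hα (eq_zero_of_pow_eq_zero hroot)
  obtain ⟨c, hc⟩ := IsAlgClosed.exists_pow_nat_eq (p.coeff 0 : Qbar) (Nat.pos_of_ne_zero hm)
  obtain ⟨h₁, h₂⟩ := isIntegral_div_of_coeff_dvd_s5 hp hroot hm h0 hc hdvd
  have hc0 : c ≠ 0 := by
    rintro rfl
    rw [zero_pow hm] at hc
    exact h0 (by exact_mod_cast hc.symm)
  intro g
  have hgα : g α ≠ 0 := (map_ne_zero g).2 hα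
  have hgc : g c ≠ 0 := (map_ne_zero g).2 hc0
  have hgcm : g c ^ p.natDegree = c ^ p.natDegree := by rw [← map_pow, hc, map_intCast]
  have hunit : ∀ {x y : Qbar}, y ≠ 0 → x ^ p.natDegree = y ^ p.natDegree →
      IsIntegral ℤ (x / y) := fun {x y} hy hxy =>
    IsIntegral.of_pow (Nat.pos_of_ne_zero hm) <| by
      rw [div_pow, hxy, div_self (pow_ne_zero _ hy)]
      exact isIntegral_one
  have e₁ : g α / α = g (α / c) * (g c / c) * (α / c)⁻¹ := by
    rw [map_div₀]; field_simp
  have e₂ : α / g α = α / c * (c / g c) * g (α / c)⁻¹ := by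
    rw [map_inv₀, map_div₀]; field_simp
  rw [image_principalSet]
  refine principalSet_eq_of_isIntegral_div hα hgα ?_ ?_
  · rw [e₁]
    exact ((map_isIntegral_int g h₁).mul (hunit hc0 hgcm)).mul h₂
  · rw [e₂]
    exact (h₁.mul (hunit hgc hgcm.symm)).mul (map_isIntegral_int g h₂)
end

section
/- Let α be an element of ℚ̄ and p(x) = x^m + a_1 x^{m-1} + … + a_m a monic polynomial with integer coefficients such that p(α) = 0, a_m ≠ 0, and for every i = 1, …, m the integer (a_i)^m is divisible by (a_m)^i. Then there exists a unit u of the ring of algebraic integers with α^m = a_m·u. -/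
open Polynomial in
/-- An invertible root of a monic polynomial with integral coefficients and constant coefficient
`1` is integral, and so is its inverse. -/
theorem isIntegral_and_isIntegral_inv_of_coeff_zero_eq_one {R K : Type*} [CommRing R] [Field K]
    [Algebra R K] {q : K[X]} (hq : q.Monic) (hdeg : q.natDegree ≠ 0) (h0 : q.coeff 0 = 1)
    (hint : ∀ i, IsIntegral R (q.coeff i)) {x : K} (hx : q.eval x = 0) :
    IsIntegral R x ∧ IsIntegral R x⁻¹ := by
  have hx0 : x ≠ 0 := by
    rintro rfl
    rw [← coeff_zero_eq_eval_zero, h0] at hx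
    exact one_ne_zero hx
  have htr : q.natTrailingDegree = 0 := natTrailingDegree_eq_zero.2 (.inr (by simp [h0]))
  have hrm : q.reverse.Monic := by
    rw [Monic, reverse_leadingCoeff, trailingCoeff, htr, h0]
  have hrd : q.reverse.natDegree ≠ 0 := by
    rwa [reverse_natDegree, htr, Nat.sub_zero]
  refine ⟨.of_aeval_monic_of_isIntegral_coeff hq hdeg (hx ▸ isIntegral_zero) hint,
    .of_aeval_monic_of_isIntegral_coeff hrm hrd ?_ fun i => ?_⟩
  · let := invertibleOfNonzero hx0
    have h := (eval₂_reverse_eq_zero_iff (RingHom.id K) x q).2 hx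
    rw [invOf_eq_inv] at h
    exact (show q.reverse.eval x⁻¹ = 0 from h) ▸ isIntegral_zero
  · rw [coeff_reverse]
    exact hint _

/-- If `α ∈ ℚ̄` is a root of a monic polynomial `p(x) = x^m + a₁ x^(m-1) + ⋯ + aₘ ∈ ℤ[x]`
(here `aᵢ = p.coeff (m - i)`) with `aₘ ≠ 0` and `(aₘ)^i ∣ (aᵢ)^m` for every `i = 1, …, m`, then
`α ^ m = aₘ · u` for some unit `u` of the ring of algebraic integers. -/
theorem pow_eq_constTerm_mul_unit_of_coeff_dvd (α : Qbar)
    (p : Polynomial ℤ) (hp : p.Monic) (hroot : Polynomial.aeval α p = 0)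
    (h0 : p.coeff 0 ≠ 0)
    (hdvd : ∀ i : ℕ, 1 ≤ i → i ≤ p.natDegree →
      (p.coeff 0) ^ i ∣ (p.coeff (p.natDegree - i)) ^ p.natDegree) :
    ∃ u : (integralClosure ℤ Qbar)ˣ,
      α ^ p.natDegree = ((p.coeff 0 : ℤ) : Qbar) * ((u : integralClosure ℤ Qbar) : Qbar) := by
  have hm : p.natDegree ≠ 0 := by
    intro h
    rw [hp.natDegree_eq_zero.1 h, map_one] at hroot
    exact one_ne_zero hroot
  obtain ⟨β, hβ⟩ := IsAlgClosed.exists_pow_nat_eq ((p.coeff 0 : ℤ) : Qbar) (Nat.pos_of_ne_zero hm)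
  have hc : ((p.coeff 0 : ℤ) : Qbar) ≠ 0 := Int.cast_ne_zero.2 h0
  have hβ0 : β ≠ 0 := by
    rintro rfl
    exact hc (by rw [← hβ, zero_pow hm])
  have hpm : (p.map (algebraMap ℤ Qbar)).natDegree = p.natDegree := hp.natDegree_map _
  have hcoeff (j : ℕ) : ((p.map (algebraMap ℤ Qbar)).scaleRoots β⁻¹).coeff j =
      (p.coeff j : Qbar) * β⁻¹ ^ (p.natDegree - j) := by
    rw [Polynomial.coeff_scaleRoots, hpm, Polynomial.coeff_map, eq_intCast]
  have key := isIntegral_and_isIntegral_inv_of_coeff_zero_eq_one (R := ℤ)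
    (q := (p.map (algebraMap ℤ Qbar)).scaleRoots β⁻¹) (x := β⁻¹ * α)
    ((Polynomial.monic_scaleRoots_iff _).2 (hp.map _))
    (by rwa [Polynomial.natDegree_scaleRoots, hpm])
    (by rw [hcoeff, Nat.sub_zero, inv_pow, hβ, mul_inv_cancel₀ hc])
    (fun j => by
      rw [hcoeff]
      rcases le_or_gt p.natDegree j with hj | hj
      · rw [Nat.sub_eq_zero_of_le hj, pow_zero, mul_one]
        exact isIntegral_algebraMap (R := ℤ) (x := p.coeff j)
      · obtain ⟨c, hcj⟩ := hdvd (p.natDegree - j) (by lia) (Nat.sub_le _ _)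
        rw [Nat.sub_sub_self hj.le] at hcj
        refine IsIntegral.of_pow (Nat.pos_of_ne_zero hm) ?_
        have : ((p.coeff j : Qbar) * β⁻¹ ^ (p.natDegree - j)) ^ p.natDegree = (c : Qbar) := by
          rw [mul_pow, ← Int.cast_pow, hcj, pow_right_comm, inv_pow, hβ]
          rw [Int.cast_mul, Int.cast_pow, inv_pow, mul_right_comm,
            mul_inv_cancel₀ (pow_ne_zero _ hc), one_mul]
        rw [this]
        exact isIntegral_algebraMap (R := ℤ) (x := c))
    (by rw [Polynomial.scaleRoots_eval_mul, Polynomial.eval_map_algebraMap, hroot, mul_zero])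
  obtain ⟨h1, h2⟩ := key
  have hα : α ≠ 0 := by
    rintro rfl
    rw [← Polynomial.coeff_zero_eq_aeval_zero', eq_intCast] at hroot
    exact hc hroot
  let u : (integralClosure ℤ Qbar)ˣ :=
    ⟨⟨_, h1⟩, ⟨_, h2⟩, Subtype.ext (mul_inv_cancel₀ (mul_ne_zero (inv_ne_zero hβ0) hα)),
      Subtype.ext (inv_mul_cancel₀ (mul_ne_zero (inv_ne_zero hβ0) hα))⟩
  refine ⟨u ^ p.natDegree, ?_⟩
  have hu : ((u : integralClosure ℤ Qbar) : Qbar) = β⁻¹ * α := rfl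
  rw [Units.val_pow_eq_pow_val, SubmonoidClass.coe_pow, hu, ← hβ, ← mul_pow,
    mul_inv_cancel_left₀ hβ0]
end

section
/- Let n be a positive integer, K the n-th cyclotomic field over ℚ, and α a nonzero element of the ring of integers 𝒪_K. Suppose the minimal polynomial x^d + a_1 x^{d-1} + … + a_d ∈ ℤ[x] of α over ℚ satisfies that (a_d)^i divides (a_i)^d for every i = 1, …, d (i.e. α is a d-number). Then there exist a positive integer m, a rational integer c, and a unit u of 𝒪_K such that α^m = c·u. (Weak form of Corollary 2.13.) -/
open Polynomial in
/-- A root of a polynomial whose constant coefficient is a unit is itself a unit. -/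
theorem Polynomial.IsRoot.isUnit_of_isUnit_coeff_zero {A : Type*} [CommRing A] {q : A[X]} {x : A}
    (hx : q.IsRoot x) (hq : IsUnit (q.coeff 0)) : IsUnit x := by
  have h : q.divX.eval x * x + q.coeff 0 = 0 := by
    rw [← hx.eq_zero]
    conv_rhs => rw [← q.divX_mul_X_add]
    simp
  refine isUnit_of_dvd_unit ⟨-q.divX.eval x, ?_⟩ hq
  linear_combination h

open Polynomial in
/-- If `x` is a root of a monic integer polynomial `p` of degree `d` with nonzero constant term
`a`, and `a ^ i` divides the `d`-th power of the coefficient of `X ^ (d - i)` for all `i`, then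
for every `d`-th root `δ` of `a` the quotient `x / δ` is a unit in the ring of algebraic
integers. -/
theorem isIntegral_div_and_inv_of_coeff_zero_pow_dvd {L : Type*} [Field L] [CharZero L]
    {p : ℤ[X]} (hp : p.Monic) (hdeg : p.natDegree ≠ 0) (hp0 : p.coeff 0 ≠ 0)
    (hdvd : ∀ i : ℕ, 1 ≤ i → i ≤ p.natDegree →
      (p.coeff 0) ^ i ∣ (p.coeff (p.natDegree - i)) ^ p.natDegree)
    {x δ : L} (hx : aeval x p = 0) (hδ : δ ^ p.natDegree = p.coeff 0) :
    IsIntegral ℤ (x / δ) ∧ IsIntegral ℤ (x / δ)⁻¹ := by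
  have ha : (p.coeff 0 : L) ≠ 0 := by exact_mod_cast hp0
  set P : L[X] := p.map (algebraMap ℤ L) with hP
  have hPdeg : P.natDegree = p.natDegree := hp.natDegree_map _
  have hQmonic : (P.scaleRoots δ⁻¹).Monic := (monic_scaleRoots_iff _).2 (hp.map _)
  have hcoeff : ∀ j, IsIntegral ℤ ((P.scaleRoots δ⁻¹).coeff j) := by
    intro j
    rw [coeff_scaleRoots, hPdeg, hP, coeff_map]
    rcases lt_or_ge p.natDegree j with hj | hj
    · simpa [coeff_eq_zero_of_natDegree_lt hj] using isIntegral_zero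
    · refine IsIntegral.of_pow (Nat.pos_of_ne_zero hdeg) ?_
      obtain ⟨k, hk⟩ : p.coeff 0 ^ (p.natDegree - j) ∣ p.coeff j ^ p.natDegree := by
        rcases Nat.eq_zero_or_pos (p.natDegree - j) with h | h
        · simp [h]
        · simpa [Nat.sub_sub_self hj] using hdvd _ h (Nat.sub_le _ _)
      have hk' : (p.coeff j : L) ^ p.natDegree = (p.coeff 0 : L) ^ (p.natDegree - j) * k := by
        exact_mod_cast hk
      have : (algebraMap ℤ L (p.coeff j) * δ⁻¹ ^ (p.natDegree - j)) ^ p.natDegree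
          = algebraMap ℤ L k := by
        rw [mul_pow, ← pow_mul, mul_comm (p.natDegree - j), pow_mul, inv_pow, hδ, eq_intCast,
          eq_intCast, hk', inv_pow]
        field_simp
      rw [this]
      exact isIntegral_algebraMap
  have hlifts : P.scaleRoots δ⁻¹ ∈ lifts (algebraMap (integralClosure ℤ L) L) :=
    (lifts_iff_coeff_lifts _).2 fun j => ⟨⟨_, hcoeff j⟩, rfl⟩
  obtain ⟨Q, hQmap, -, hQ⟩ := lifts_and_natDegree_eq_and_monic hlifts hQmonic
  have hroot : aeval (x / δ) Q = 0 := by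
    have h : aeval x P = 0 := by rwa [hP, aeval_map_algebraMap]
    have := scaleRoots_aeval_eq_zero (r := δ⁻¹) h
    rwa [← hQmap, aeval_map_algebraMap, Algebra.algebraMap_self_apply, mul_comm,
      ← div_eq_mul_inv] at this
  have hint : IsIntegral ℤ (x / δ) := isIntegral_trans _ ⟨Q, hQ, hroot⟩
  have hQ0 : Q.coeff 0 = 1 := by
    apply Subtype.coe_injective
    change algebraMap (integralClosure ℤ L) L (Q.coeff 0) = 1
    rw [← coeff_map, hQmap, coeff_scaleRoots, hPdeg, hP, coeff_map, Nat.sub_zero, inv_pow, hδ,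
      eq_intCast, mul_inv_cancel₀ ha]
  have hQroot : Q.IsRoot ⟨x / δ, hint⟩ := by
    apply Subtype.coe_injective
    change algebraMap (integralClosure ℤ L) L _ = 0
    rw [← aeval_algebraMap_apply_eq_algebraMap_eval]
    exact hroot
  obtain ⟨y, hy⟩ := (hQroot.isUnit_of_isUnit_coeff_zero (by simp [hQ0])).exists_right_inv
  refine ⟨hint, ?_⟩
  rw [← eq_inv_of_mul_eq_one_right (congrArg Subtype.val hy)]
  exact y.2


/-- Weak form of Corollary 2.13: if a nonzero element `α` of the ring of integers of the `n`-th
cyclotomic field `K` is a d-number (expressed via the divisibility characterization (v) of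
Lemma 2.10 on its monic minimal polynomial `p(x) = x^d + a₁ x^(d-1) + ⋯ + a_d ∈ ℤ[x]` over `ℚ`,
with `aᵢ = p.coeff (d - i)`), then some positive power of `α` is a rational integer times a unit
of `𝒪_K`. -/
theorem cyclotomic_dNumber_pow_eq_int_mul_unit (n : ℕ+)
    (α : NumberField.RingOfIntegers (CyclotomicField n ℚ)) (hα : α ≠ 0)
    (p : Polynomial ℤ) (hp : p.Monic)
    (hmin : p.map (algebraMap ℤ ℚ) = minpoly ℚ (α : CyclotomicField n ℚ))
    (hdvd : ∀ i : ℕ, 1 ≤ i → i ≤ p.natDegree →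
      (p.coeff 0) ^ i ∣ (p.coeff (p.natDegree - i)) ^ p.natDegree) :
    ∃ (m : ℕ) (c : ℤ) (u : (NumberField.RingOfIntegers (CyclotomicField n ℚ))ˣ),
      0 < m ∧ α ^ m = (c : NumberField.RingOfIntegers (CyclotomicField n ℚ)) * u := by
  have hnat : (minpoly ℚ (α : CyclotomicField n ℚ)).natDegree = p.natDegree := by
    rw [← hmin, hp.natDegree_map]
  have hint : IsIntegral ℚ (α : CyclotomicField n ℚ) := Algebra.IsIntegral.isIntegral _
  have hdeg : p.natDegree ≠ 0 := hnat ▸ (minpoly.natDegree_pos hint).ne'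
  have hα' : (α : CyclotomicField n ℚ) ≠ 0 := by simpa using hα
  have hp0 : p.coeff 0 ≠ 0 := by
    intro h
    apply minpoly.coeff_zero_ne_zero hint hα'
    rw [← hmin, Polynomial.coeff_map, h, map_zero]
  let L := AlgebraicClosure (CyclotomicField n ℚ)
  have hroot : Polynomial.aeval (algebraMap (CyclotomicField n ℚ) L α) p = 0 := by
    rw [Polynomial.aeval_algebraMap_apply, ← Polynomial.aeval_map_algebraMap ℚ, hmin,
      minpoly.aeval, map_zero]
  obtain ⟨δ, hδ⟩ := IsAlgClosed.exists_pow_nat_eq (p.coeff 0 : L) (Nat.pos_of_ne_zero hdeg)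
  obtain ⟨h₁, h₂⟩ := isIntegral_div_and_inv_of_coeff_zero_pow_dvd hp hdeg hp0 hdvd hroot hδ
  have ha : (p.coeff 0 : CyclotomicField n ℚ) ≠ 0 := by exact_mod_cast hp0
  set w : CyclotomicField n ℚ := (α : CyclotomicField n ℚ) ^ p.natDegree / p.coeff 0 with hw
  have hwL : algebraMap _ L w = (algebraMap (CyclotomicField n ℚ) L α / δ) ^ p.natDegree := by
    rw [hw, map_div₀, map_pow, div_pow, hδ, map_intCast]
  have hinj := (algebraMap (CyclotomicField n ℚ) L).injective
  have hw₁ : IsIntegral ℤ w := by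
    rw [← isIntegral_algebraMap_iff hinj, hwL]
    exact h₁.pow _
  have hw₂ : IsIntegral ℤ w⁻¹ := by
    rw [← isIntegral_algebraMap_iff hinj, map_inv₀, hwL, ← inv_pow]
    exact h₂.pow _
  have hw0 : w ≠ 0 := div_ne_zero (pow_ne_zero _ hα') ha
  refine ⟨p.natDegree, p.coeff 0, ⟨⟨w, hw₁⟩, ⟨w⁻¹, hw₂⟩, ?_, ?_⟩, Nat.pos_of_ne_zero hdeg, ?_⟩
  · exact NumberField.RingOfIntegers.ext (mul_inv_cancel₀ hw0)
  · exact NumberField.RingOfIntegers.ext (inv_mul_cancel₀ hw0)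
  · apply NumberField.RingOfIntegers.ext
    change algebraMap _ (CyclotomicField n ℚ) _ = algebraMap _ (CyclotomicField n ℚ) _
    rw [map_pow, map_mul, map_intCast]
    exact (mul_div_cancel₀ _ ha).symm
end

section
/- Let α be an element of ℚ̄ satisfying α³ − 26α² + 148α − 148 = 0. Then α is an algebraic integer which is not a d-number; that is, there exists a field automorphism g of ℚ̄ with g(α𝔸) ≠ α𝔸 (equivalently, α/g(α) is not an algebraic integer). (Claim from Example 1.5.) -/
open Polynomial in
theorem irreducible_codegree_poly :
    Irreducible (X ^ 3 - 26 * X ^ 2 + 148 * X - 148 : ℤ[X]) := by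
  have hdeg : (X ^ 3 - 26 * X ^ 2 + 148 * X - 148 : ℤ[X]).natDegree = 3 := by compute_degree!
  have hmonic : (X ^ 3 - 26 * X ^ 2 + 148 * X - 148 : ℤ[X]).Monic := by monicity!
  rw [hmonic.irreducible_iff_roots_eq_zero_of_degree_le_three (by omega) (by omega),
    Multiset.eq_zero_iff_forall_notMem]
  intro a ha
  have hroot := (mem_roots'.mp ha).2
  simp only [IsRoot.def, eval_sub, eval_add, eval_mul, eval_pow, eval_X, eval_ofNat] at hroot
  have hmod := congrArg (Int.cast : ℤ → ZMod 3) hroot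
  push_cast at hmod
  generalize (a : ZMod 3) = b at hmod
  revert b
  decide

theorem isIntegral_of_codegree_poly_root {α : Qbar}
    (h : α ^ 3 - 26 * α ^ 2 + 148 * α - 148 = 0) : IsIntegral ℤ α := by
  refine ⟨Polynomial.X ^ 3 - 26 * Polynomial.X ^ 2 + 148 * Polynomial.X - 148, by monicity!, ?_⟩
  simpa [Polynomial.eval₂_sub, Polynomial.eval₂_add, Polynomial.eval₂_mul] using h

theorem minpoly_of_codegree_poly_root {α : Qbar}
    (h : α ^ 3 - 26 * α ^ 2 + 148 * α - 148 = 0) :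
    minpoly ℚ α = (Polynomial.X ^ 3 - 26 * Polynomial.X ^ 2 + 148 * Polynomial.X - 148 :
      Polynomial ℤ).map (algebraMap ℤ ℚ) := by
  have hmonic : (Polynomial.X ^ 3 - 26 * Polynomial.X ^ 2 + 148 * Polynomial.X - 148 :
      Polynomial ℤ).Monic := by monicity!
  refine (minpoly.eq_of_irreducible_of_monic
    (hmonic.irreducible_iff_irreducible_map_fraction_map.mp irreducible_codegree_poly) ?_
    (hmonic.map _)).symm
  simpa [map_ofNat] using h

theorem exists_algEquiv_of_codegree_poly_roots {α β : Qbar}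
    (hα : α ^ 3 - 26 * α ^ 2 + 148 * α - 148 = 0)
    (hβ : β ^ 3 - 26 * β ^ 2 + 148 * β - 148 = 0) :
    ∃ g : Qbar ≃ₐ[ℚ] Qbar, g α = β := by
  have hconj : IsConjRoot ℚ β α :=
    (minpoly_of_codegree_poly_root hβ).trans (minpoly_of_codegree_poly_root hα).symm
  have : IsAlgClosure ℚ Qbar := by
    convert (inferInstance : @IsAlgClosure ℚ Qbar _ _ (AlgebraicClosure.instAlgebra ℚ) _)
    exact Subsingleton.elim _ _
  have : Normal ℚ Qbar := IsAlgClosure.normal ℚ Qbar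
  exact isConjRoot_iff_exists_algEquiv.mp hconj

theorem exists_other_codegree_poly_roots {α : Qbar}
    (h : α ^ 3 - 26 * α ^ 2 + 148 * α - 148 = 0) :
    ∃ β γ : Qbar, β ^ 3 - 26 * β ^ 2 + 148 * β - 148 = 0 ∧
      γ ^ 3 - 26 * γ ^ 2 + 148 * γ - 148 = 0 ∧ α + β + γ = 26 ∧ α * β * γ = 148 := by
  obtain ⟨β, hβ⟩ := IsAlgClosed.exists_root
    (Polynomial.X ^ 2 + Polynomial.C (α - 26) * Polynomial.X
      + Polynomial.C (α ^ 2 - 26 * α + 148) : Polynomial Qbar)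
    (by
      have : (Polynomial.X ^ 2 + Polynomial.C (α - 26) * Polynomial.X
        + Polynomial.C (α ^ 2 - 26 * α + 148) : Polynomial Qbar).degree = 2 := by compute_degree!
      rw [this]; decide)
  have hquad : β ^ 2 + (α - 26) * β + (α ^ 2 - 26 * α + 148) = 0 := by simpa using hβ
  refine ⟨β, 26 - α - β, ?_, ?_, by ring, ?_⟩
  · linear_combination (β - α) * hquad + h
  · linear_combination (26 - 2 * α - β) * hquad + h
  · linear_combination h - α * hquad

theorem exists_not_isIntegral_div_of_codegree_poly_root {α : Qbar}
    (h : α ^ 3 - 26 * α ^ 2 + 148 * α - 148 = 0) :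
    ∃ g : Qbar ≃ₐ[ℚ] Qbar, ¬ IsIntegral ℤ (α / g α) := by
  by_contra! hall
  obtain ⟨β, γ, hβ, hγ, hsum, hprod⟩ := exists_other_codegree_poly_roots h
  have hα0 : α ≠ 0 := by
    rintro rfl
    norm_num at h
  have conj_div : ∀ {δ : Qbar}, δ ^ 3 - 26 * δ ^ 2 + 148 * δ - 148 = 0 →
      IsIntegral ℤ (δ / α) := by
    intro δ hδ
    obtain ⟨g, rfl⟩ := exists_algEquiv_of_codegree_poly_roots h hδ
    simpa using (hall g.symm).map (g : Qbar →+* Qbar).toIntAlgHom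
  have hint : IsIntegral ℤ (26 / α) := by
    rw [← hsum, add_div, add_div]
    exact ((conj_div h).add (conj_div hβ)).add (conj_div hγ)
  have conj_int : ∀ {δ : Qbar}, δ ^ 3 - 26 * δ ^ 2 + 148 * δ - 148 = 0 →
      IsIntegral ℤ (26 / δ) := by
    intro δ hδ
    obtain ⟨g, rfl⟩ := exists_algEquiv_of_codegree_poly_roots h hδ
    simpa [map_ofNat] using hint.map (g : Qbar →+* Qbar).toIntAlgHom
  have hnorm : IsIntegral ℤ (algebraMap ℚ Qbar (4394 / 37)) := by
    have heq : algebraMap ℚ Qbar (4394 / 37) = 26 / α * (26 / β) * (26 / γ) := by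
      rw [div_mul_div_comm, div_mul_div_comm, hprod, map_div₀, map_ofNat, map_ofNat]
      norm_num
    rw [heq]
    exact ((conj_int h).mul (conj_int hβ)).mul (conj_int hγ)
  rw [isIntegral_algebraMap_iff (algebraMap ℚ Qbar).injective] at hnorm
  obtain ⟨n, hn⟩ := IsIntegrallyClosed.isIntegral_iff.mp hnorm
  have hn' : (n : ℚ) * 37 = 4394 := by
    rw [show (n : ℚ) = 4394 / 37 from hn]
    norm_num
  have : n * 37 = 4394 := by exact_mod_cast hn'
  omega

theorem isIntegral_div_of_image_principalSet_eq {α : Qbar} (g : Qbar ≃+* Qbar) (hα : α ≠ 0)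
    (h : g '' principalSet α = principalSet α) : IsIntegral ℤ (α / g α) := by
  have hmem : α ∈ g '' principalSet α := by
    rw [h]
    exact ⟨1, isIntegral_one, (mul_one α).symm⟩
  obtain ⟨_, ⟨β, hβ, rfl⟩, hx⟩ := hmem
  have hdiv : α / g α = g β := by
    rw [div_eq_iff ((map_ne_zero g).mpr hα), mul_comm, ← map_mul, hx]
  rw [hdiv]
  exact hβ.map (g : Qbar →+* Qbar).toIntAlgHom

/-- Claim from Example 1.5: a root `α ∈ ℚ̄` of `t³ − 26t² + 148t − 148` is an algebraic integer
which is not a d-number: some field automorphism `g` of `ℚ̄` satisfies `g(α𝔸) ≠ α𝔸`,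
equivalently `α / g(α)` is not an algebraic integer. -/
theorem root_codegree_poly_not_dNumber (α : Qbar)
    (h : α ^ 3 - 26 * α ^ 2 + 148 * α - 148 = 0) :
    IsIntegral ℤ α ∧ ∃ g : Qbar ≃+* Qbar,
      g '' principalSet α ≠ principalSet α ∧ ¬ IsIntegral ℤ (α / g α) := by
  obtain ⟨g, hg⟩ := exists_not_isIntegral_div_of_codegree_poly_root h
  have hα0 : α ≠ 0 := by
    rintro rfl
    norm_num at h
  exact ⟨isIntegral_of_codegree_poly_root h, g.toRingEquiv,
    fun himage => hg (isIntegral_div_of_image_principalSet_eq g.toRingEquiv hα0 himage), hg⟩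
end

section
/- Let x and y be complex numbers satisfying x² = 1 + 2y, y² = 1 + x + 2y, and xy = 2x + y, and set f = 1 + x² + y². Then f³ − 26f² + 148f − 148 = 0. (Computation of the formal codegrees of the based ring K(2,1,0,2) from Example 1.5.) -/
/-- Computation from Example 1.5: if `(x, y) = (χ(X), χ(Y))` for a ring homomorphism `χ` from
the based ring `K(2,1,0,2)` to `ℂ`, then the corresponding formal codegree `f = 1 + x² + y²`
is a root of `t³ − 26t² + 148t − 148`. -/
theorem codegree_K2102_root (x y : ℂ) (h1 : x ^ 2 = 1 + 2 * y)
    (h2 : y ^ 2 = 1 + x + 2 * y) (h3 : x * y = 2 * x + y)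
    (f : ℂ) (hf : f = 1 + x ^ 2 + y ^ 2) :
    f ^ 3 - 26 * f ^ 2 + 148 * f - 148 = 0 := by
  have hx : x ^ 3 - x ^ 2 - 5 * x + 1 = 0 := by
    linear_combination (x - 1) * h1 + 2 * h3
  have hfx : f = 2 * x ^ 2 + x + 1 := by
    linear_combination hf + h2 - h1
  rw [hfx]
  linear_combination (8 * x ^ 3 + 20 * x ^ 2 - 26 * x - 25) * hx
end
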